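/- arXiv:1504.04195 — 2 statements merged into one kernel-verified Lean document; each statement's English description precedes it below -/
import Mathlib

section
/- For every integer n ≥ 10, the spectral radius μ_2 = μ(EP'_n) satisfies the equation (μ_2 − n + 9)((μ_2² − 2μ_2 − 2)(μ_2 − 1) − 2μ_2) − (2n − 16)(μ_2² − 2μ_2 − 2) = 0. -/
open SimpleGraph

/-- A graph is claw-free if it contains no induced `K_{1,3}`. -/
def ClawFree {V : Type*} (G : SimpleGraph V) : Prop :=
  ¬ ∃ v a b c : V, a ≠ b ∧ a ≠ c ∧ b ≠ c ∧
    G.Adj v a ∧ G.Adj v b ∧ G.Adj v c ∧ ¬ G.Adj a b ∧ ¬ G.Adj a c ∧ ¬ G.Adj b c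

/-- A graph is traceable if it has a Hamilton path. -/
def Traceable {V : Type*} (G : SimpleGraph V) : Prop := by
  classical
  exact ∃ (u v : V) (p : G.Walk u v), p.IsHamiltonian

/-- A graph is 2-connected if it has at least 3 vertices and deleting any
single vertex leaves a connected graph. -/
def TwoConnected {V : Type*} [Fintype V] (G : SimpleGraph V) : Prop :=
  3 ≤ Fintype.card V ∧ ∀ v : V, (G.induce ({v}ᶜ : Set V)).Connected

/-- A vertex is eligible if its neighbourhood induces a connected non-complete graph. -/
def Eligible {V : Type*} (G : SimpleGraph V) (x : V) : Prop :=
  (G.induce (G.neighborSet x)).Connected ∧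
    ∃ u v : V, G.Adj x u ∧ G.Adj x v ∧ u ≠ v ∧ ¬ G.Adj u v

/-- A claw-free graph is closed if it has no eligible vertex. -/
def IsClosedGraph {V : Type*} (G : SimpleGraph V) : Prop := ∀ x : V, ¬ Eligible G x

/-- The spectral radius of a graph: the largest eigenvalue of its adjacency matrix. -/
noncomputable def adjSpectralRadius {V : Type*} [Fintype V] (G : SimpleGraph V) : ℝ := by
  classical
  exact sSup {μ : ℝ | ∃ x : V → ℝ, x ≠ 0 ∧ (G.adjMatrix ℝ).mulVec x = μ • x}

/-- The `Q`-index of a graph: the largest eigenvalue of `Q = D + A`. -/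
noncomputable def qIndex {V : Type*} [Fintype V] (G : SimpleGraph V) : ℝ := by
  classical
  exact sSup {μ : ℝ | ∃ x : V → ℝ, x ≠ 0 ∧
    (Matrix.diagonal (fun v => (G.degree v : ℝ)) + G.adjMatrix ℝ).mulVec x = μ • x}

/-- `EN n`: the complete graph on `{0, …, n-4}` together with pendant vertices
`n-3, n-2, n-1` attached to `0, 1, 2` respectively. -/
def ENgraph (n : ℕ) : SimpleGraph (Fin n) :=
  SimpleGraph.fromRel (fun i j =>
    (i.val < n - 3 ∧ j.val < n - 3) ∨ j.val = i.val + (n - 3))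

/-- `EP n`: a clique on `{0,…,n-7}` with `a_i = i`, a triangle `b_i = n-6+i`,
and vertices `c_i = n-3+i` with edges `a_i b_i`, `a_i c_i`, `b_i c_i` (`i = 0,1,2`). -/
def EPgraph (n : ℕ) : SimpleGraph (Fin n) :=
  SimpleGraph.fromRel (fun i j =>
    (i.val < n - 6 ∧ j.val < n - 6) ∨
    (n - 6 ≤ i.val ∧ i.val < n - 3 ∧ n - 6 ≤ j.val ∧ j.val < n - 3) ∨
    (i.val < 3 ∧ (j.val = i.val + (n - 6) ∨ j.val = i.val + (n - 3))) ∨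
    (n - 6 ≤ i.val ∧ i.val < n - 3 ∧ j.val = i.val + 3))

/-- `EP' n`: a clique on `{0,…,n-7}` with `a₁ = 0`, `b₁ = 1`, `c₁ = 2`, triangles
`a₁a₂a₃` and `b₁b₂b₃` where `a₂ = n-6`, `a₃ = n-5`, `b₂ = n-4`, `b₃ = n-3`, and
vertices `c₂ = n-2`, `c₃ = n-1` with edges `a_i b_i`, `a_i c_i`, `b_i c_i` for `i = 2,3`. -/
def EP'graph (n : ℕ) : SimpleGraph (Fin n) :=
  SimpleGraph.fromRel (fun i j =>
    (i.val < n - 6 ∧ j.val < n - 6) ∨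
    (i.val = 0 ∧ (j.val = n - 6 ∨ j.val = n - 5)) ∨
    (i.val = 1 ∧ (j.val = n - 4 ∨ j.val = n - 3)) ∨
    (i.val = n - 6 ∧ (j.val = n - 5 ∨ j.val = n - 4 ∨ j.val = n - 2)) ∨
    (i.val = n - 5 ∧ (j.val = n - 3 ∨ j.val = n - 1)) ∨
    (i.val = n - 4 ∧ (j.val = n - 3 ∨ j.val = n - 2)) ∨
    (i.val = n - 3 ∧ j.val = n - 1))

/-- A positive eigenvector of the adjacency matrix belongs to the spectral radius. -/
theorem adjSpectralRadius_eq_of_pos_eigenvector {V : Type*} [Fintype V] [Nonempty V]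
    (G : SimpleGraph V) [DecidableRel G.Adj] {w : V → ℝ} {l : ℝ} (hw : ∀ i, 0 < w i)
    (h : (G.adjMatrix ℝ).mulVec w = l • w) : adjSpectralRadius G = l := by
  classical
  unfold adjSpectralRadius
  refine IsGreatest.csSup_eq ⟨⟨w, ?_, ?_⟩, ?_⟩
  · rintro rfl
    exact lt_irrefl _ (hw (Classical.arbitrary V))
  · convert h
  · rintro μ ⟨x, hx, hxe⟩
    replace hxe : (G.adjMatrix ℝ).mulVec x = μ • x := by convert hxe
    have hsum : 0 < ∑ i, w i * |x i| := by
      obtain ⟨i, hi⟩ := Function.ne_iff.mp hx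
      exact Finset.sum_pos' (fun j _ => mul_nonneg (hw j).le (abs_nonneg _))
        ⟨i, Finset.mem_univ _, mul_pos (hw i) (abs_pos.mpr hi)⟩
    have hle : |μ| * ∑ i, w i * |x i| ≤ l * ∑ i, w i * |x i| := by
      calc |μ| * ∑ i, w i * |x i| = ∑ i, w i * |(μ • x) i| := by
            simp only [Finset.mul_sum, Pi.smul_apply, smul_eq_mul, abs_mul]
            exact Finset.sum_congr rfl fun i _ => by ring
        _ ≤ ∑ i, w i * ∑ j, G.adjMatrix ℝ i j * |x j| := by
            refine Finset.sum_le_sum fun i _ => mul_le_mul_of_nonneg_left ?_ (hw i).le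
            rw [← hxe]
            refine (Finset.abs_sum_le_sum_abs _ _).trans (Finset.sum_le_sum fun j _ => ?_)
            rw [abs_mul, abs_of_nonneg]
            simp only [adjMatrix_apply]
            split_ifs <;> norm_num
        _ = ∑ j, |x j| * (G.adjMatrix ℝ).mulVec w j := by
            simp only [Matrix.mulVec, dotProduct, Finset.mul_sum]
            rw [Finset.sum_comm]
            refine Finset.sum_congr rfl fun j _ => Finset.sum_congr rfl fun i _ => ?_
            simp only [adjMatrix_apply, G.adj_comm i j]
            ring
        _ = l * ∑ i, w i * |x i| := by
            rw [h, Finset.mul_sum]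
            exact Finset.sum_congr rfl fun i _ => by
              simp only [Pi.smul_apply, smul_eq_mul]; ring
    exact (le_abs_self μ).trans (le_of_mul_le_mul_right hle hsum)

theorem sum_fin_add_ten (m : ℕ) (f : ℕ → ℝ) :
    ∑ j : Fin (m + 10), f j = f 0 + f 1 + ∑ j ∈ Finset.range (m + 2), f (j + 2) +
      f (m + 4) + f (m + 5) + f (m + 6) + f (m + 7) + f (m + 8) + f (m + 9) := by
  rw [Fin.sum_univ_eq_sum_range]
  rw [Finset.sum_range_succ, Finset.sum_range_succ, Finset.sum_range_succ,
    Finset.sum_range_succ, Finset.sum_range_succ, Finset.sum_range_succ,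
    Finset.sum_range_succ', Finset.sum_range_succ']
  ring

/-- The adjacency relation of `EP'graph (m + 10)`, read on natural numbers. -/
def EP'Rel (m i j : ℕ) : Prop :=
  (i < m + 4 ∧ j < m + 4) ∨
  (i = 0 ∧ (j = m + 4 ∨ j = m + 5)) ∨
  (i = 1 ∧ (j = m + 6 ∨ j = m + 7)) ∨
  (i = m + 4 ∧ (j = m + 5 ∨ j = m + 6 ∨ j = m + 8)) ∨
  (i = m + 5 ∧ (j = m + 7 ∨ j = m + 9)) ∨
  (i = m + 6 ∧ (j = m + 7 ∨ j = m + 8)) ∨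
  (i = m + 7 ∧ j = m + 9)

instance (m i j : ℕ) : Decidable (EP'Rel m i j) := by unfold EP'Rel; infer_instance

theorem EP'graph_adj_iff (m : ℕ) (i j : Fin (m + 10)) :
    (EP'graph (m + 10)).Adj i j ↔
      (i : ℕ) ≠ j ∧ (EP'Rel m i j ∨ EP'Rel m j i) := by
  simp only [EP'graph, EP'Rel, fromRel_adj, ne_eq, Fin.ext_iff, Nat.reduceSubDiff]

/-- The vector constant on the cells `{a₁, b₁}`, `{a₂, a₃, b₂, b₃}`, `{c₂, c₃}` and the rest
of the clique, with values `p`, `q`, `r`, `s` respectively. -/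
def EP'Weight (m : ℕ) (p q r s : ℝ) (j : ℕ) : ℝ :=
  if j < 2 then p else if j < m + 4 then s else if j < m + 8 then q else r

theorem EP'graph_mulVec_weight (m : ℕ) [DecidableRel (EP'graph (m + 10)).Adj]
    {l p q r s : ℝ} (hp : p + (m + 2) * s + 2 * q = l * p) (hq : p + 2 * q + r = l * q)
    (hr : 2 * q = l * r) (hs : 2 * p + (m + 1) * s = l * s) :
    ((EP'graph (m + 10)).adjMatrix ℝ).mulVec (fun j => EP'Weight m p q r s j) =
      l • fun j : Fin (m + 10) => EP'Weight m p q r s j := by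
  ext ⟨i, hi⟩
  have hsum := sum_fin_add_ten m fun j =>
    if i ≠ j ∧ (EP'Rel m i j ∨ EP'Rel m j i) then EP'Weight m p q r s j else 0
  have hinner : ∀ j ∈ Finset.range (m + 2),
      (if i ≠ j + 2 ∧ (EP'Rel m i (j + 2) ∨ EP'Rel m (j + 2) i) then
        EP'Weight m p q r s (j + 2) else 0) =
      if i < m + 4 then s - (if i = j + 2 then s else 0) else 0 := by
    intro j hj
    have hj := Finset.mem_range.mp hj
    by_cases h : i < m + 4
    · by_cases h' : i = j + 2
      · simp [h']
      · have : EP'Rel m i (j + 2) := Or.inl ⟨h, by omega⟩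
        simp [h, h', this, EP'Weight]
        omega
    · have : ¬ (EP'Rel m i (j + 2) ∨ EP'Rel m (j + 2) i) := by
        unfold EP'Rel; omega
      simp [h, this]
  have key : ((EP'graph (m + 10)).adjMatrix ℝ).mulVec (fun j => EP'Weight m p q r s j) ⟨i, hi⟩ =
      ∑ j : Fin (m + 10), if i ≠ (j : ℕ) ∧ (EP'Rel m i j ∨ EP'Rel m j i) then
        EP'Weight m p q r s j else 0 := by
    simp only [Matrix.mulVec, dotProduct, adjMatrix_apply, EP'graph_adj_iff, ite_mul, one_mul,
      zero_mul]
  rw [key, hsum, Finset.sum_congr rfl hinner]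
  simp only [Pi.smul_apply, smul_eq_mul]
  obtain h | h | h | h | h | h | h | h | h : i = 0 ∨ i = 1 ∨ (2 ≤ i ∧ i < m + 4) ∨ i = m + 4 ∨
      i = m + 5 ∨ i = m + 6 ∨ i = m + 7 ∨ i = m + 8 ∨ i = m + 9 := by omega
  case inr.inr.inl =>
    obtain ⟨k, rfl⟩ := Nat.exists_eq_add_of_le' h.1
    have hk : k < m + 2 := by omega
    have e : ∀ a, 4 ≤ a → ¬ EP'Rel m (k + 2) (m + a) ∧ ¬ EP'Rel m (m + a) (k + 2) := by
      intro a ha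
      unfold EP'Rel
      omega
    have e0 : EP'Rel m (k + 2) 0 := Or.inl ⟨h.2, by omega⟩
    have e1 : EP'Rel m (k + 2) 1 := Or.inl ⟨h.2, by omega⟩
    simp [h.2, e, e0, e1, EP'Weight, Finset.sum_sub_distrib, hk]
    linarith
  all_goals
    subst h
    simp [EP'Rel, EP'Weight]
    linarith

/-- The quotient characteristic polynomial has a root in `[m + 3, m + 4]`. -/
theorem exists_EP'_root (m : ℕ) : ∃ l : ℝ, (m : ℝ) + 3 ≤ l ∧
    (l - m - 1) * ((l ^ 2 - 2 * l - 2) * (l - 1) - 2 * l) -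
      (2 * m + 4) * (l ^ 2 - 2 * l - 2) = 0 := by
  have hm : (0 : ℝ) ≤ m := m.cast_nonneg
  let f : ℝ → ℝ := fun l => (l - m - 1) * ((l ^ 2 - 2 * l - 2) * (l - 1) - 2 * l) -
    (2 * m + 4) * (l ^ 2 - 2 * l - 2)
  have hf : ContinuousOn f (Set.Icc (m + 3 : ℝ) (m + 4)) := by fun_prop
  have hlo : f (m + 3) ≤ 0 := by
    have : f (m + 3) = -4 * (m + 3) := by simp only [f]; ring
    linarith
  have hhi : 0 ≤ f (m + 4) := by
    have : f (m + 4) = m ^ 3 + 11 * m ^ 2 + 30 * m + 6 := by simp only [f]; ring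
    rw [this]
    positivity
  obtain ⟨l, hl, hl0⟩ := intermediate_value_Icc (by linarith) hf ⟨hlo, hhi⟩
  exact ⟨l, hl.1, hl0⟩

theorem statement_14 (n : ℕ) (hn : 10 ≤ n) :
    (adjSpectralRadius (EP'graph n) - (n : ℝ) + 9) *
        (((adjSpectralRadius (EP'graph n)) ^ 2 - 2 * adjSpectralRadius (EP'graph n) - 2) *
            (adjSpectralRadius (EP'graph n) - 1) -
          2 * adjSpectralRadius (EP'graph n)) -
      (2 * (n : ℝ) - 16) *
        ((adjSpectralRadius (EP'graph n)) ^ 2 - 2 * adjSpectralRadius (EP'graph n) - 2) = 0 := by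
  obtain ⟨m, rfl⟩ := Nat.exists_eq_add_of_le' hn
  classical
  obtain ⟨l, hl, hroot⟩ := exists_EP'_root m
  have hm : (0 : ℝ) ≤ m := m.cast_nonneg
  have hD : 0 < l ^ 2 - 2 * l - 2 := by nlinarith
  have hE : 0 < l - m - 1 := by linarith
  have hρ : adjSpectralRadius (EP'graph (m + 10)) = l := by
    refine adjSpectralRadius_eq_of_pos_eigenvector _ (fun j => ?_)
      (EP'graph_mulVec_weight m (p := (l ^ 2 - 2 * l - 2) * (l - m - 1)) (q := l * (l - m - 1))
        (r := 2 * (l - m - 1)) (s := 2 * (l ^ 2 - 2 * l - 2)) ?_ ?_ ?_ ?_)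
    · have hl0 : 0 < l := by linarith
      unfold EP'Weight
      split_ifs <;> positivity
    · linear_combination -hroot
    all_goals ring
  rw [hρ]
  push_cast
  linear_combination hroot
end

section
/- For every integer n ≥ 10, the signless Laplacian spectral radius q_1 = q(EP_n) satisfies the equation (3n − 27)(q_1² − 8q_1 + 11) = (q_1 − 2n + 17)((q_1 − n + 3)(q_1² − 8q_1 + 11) − (2q_1 − 6)). -/
open SimpleGraph

open Finset in
theorem signlessLaplacian_mulVec_apply {V : Type*} [Fintype V] [DecidableEq V]
    (G : SimpleGraph V) [DecidableRel G.Adj] (x : V → ℝ) (i : V) :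
    (Matrix.diagonal (fun v => (G.degree v : ℝ)) + G.adjMatrix ℝ).mulVec x i =
      ∑ j, if G.Adj i j then x i + x j else 0 := by
  rw [Matrix.add_mulVec, Pi.add_apply, Matrix.mulVec_diagonal,
    SimpleGraph.adjMatrix_mulVec_apply, ← sum_filter, ← G.neighborFinset_eq_filter,
    sum_add_distrib, sum_const, G.card_neighborFinset_eq_degree, nsmul_eq_mul]

/-- A positive eigenvector of the signless Laplacian belongs to the `Q`-index. -/
theorem qIndex_eq_of_pos_eigenvector {V : Type*} [Fintype V] [Nonempty V]
    (G : SimpleGraph V) [DecidableRel G.Adj] (v : V → ℝ) (ρ : ℝ) (hv : ∀ i, 0 < v i)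
    (h : ∀ i, (∑ j, if G.Adj i j then v i + v j else 0) = ρ * v i) :
    qIndex G = ρ := by
  classical
  unfold qIndex
  apply IsGreatest.csSup_eq
  constructor
  · refine ⟨v, fun h0 => ?_, ?_⟩
    · obtain ⟨i⟩ := ‹Nonempty V›
      exact (hv i).ne' (congrFun h0 i)
    · funext i
      rw [signlessLaplacian_mulVec_apply, Pi.smul_apply, smul_eq_mul, ← h i]
      exact Finset.sum_congr rfl fun j _ => by congr
  · rintro μ ⟨y, hy, hμ⟩
    obtain ⟨i, hi⟩ := Finite.exists_max (fun j => |y j| / v j)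
    have hle : ∀ j, |y j| ≤ |y i| / v i * v j := fun j =>
      (div_le_iff₀ (hv j)).1 (hi j)
    have hyi : 0 < |y i| := by
      by_contra! h0
      have h1 : |y i| = 0 := le_antisymm h0 (abs_nonneg _)
      refine hy (funext fun j => ?_)
      have := hle j
      rw [h1, zero_div, zero_mul] at this
      exact abs_nonpos_iff.1 this
    have hμi := congrFun hμ i
    rw [signlessLaplacian_mulVec_apply, Pi.smul_apply, smul_eq_mul] at hμi
    have key : μ * |y i| ≤ ρ * |y i| :=
      calc μ * |y i| ≤ |μ * y i| := by
            rw [abs_mul]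
            exact mul_le_mul_of_nonneg_right (le_abs_self μ) (abs_nonneg _)
        _ ≤ ∑ j, |if G.Adj i j then y i + y j else 0| := by
            rw [← hμi]
            refine (Finset.abs_sum_le_sum_abs _ _).trans_eq ?_
            exact Finset.sum_congr rfl fun j _ => by congr
        _ ≤ ∑ j, |y i| / v i * (if G.Adj i j then v i + v j else 0) := by
            refine Finset.sum_le_sum fun j _ => ?_
            split_ifs
            · rw [mul_add]
              exact (abs_add_le _ _).trans (add_le_add (hle i) (hle j))
            · simp
        _ = ρ * |y i| := by
            rw [← Finset.mul_sum, h i]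
            field_simp [(hv i).ne']
    exact le_of_mul_le_mul_right key hyi

/-- The entries of a vector on `EPgraph (m + 9)` that is constant on the `a_i`, the remaining
clique vertices, the `b_i` and the `c_i`. -/
noncomputable def epVector (m : ℕ) (a d b c : ℝ) (i : ℕ) : ℝ :=
  if i < 3 then a else if i < m + 3 then d else if i < m + 6 then b else c

theorem sum_range_add_nine (m : ℕ) (f : ℕ → ℝ) :
    ∑ j ∈ Finset.range (m + 9), f j = f 0 + f 1 + f 2 + ∑ k ∈ Finset.range m, f (k + 3) +
      f (m + 3) + f (m + 4) + f (m + 5) + f (m + 6) + f (m + 7) + f (m + 8) := by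
  iterate 6 rw [Finset.sum_range_succ]
  iterate 3 rw [Finset.sum_range_succ']
  ring

theorem EPgraph_adj_iff (m : ℕ) (i j : Fin (m + 9)) : (EPgraph (m + 9)).Adj i j ↔
    i.val ≠ j.val ∧ ((i.val < m + 3 ∧ j.val < m + 3) ∨
      (m + 3 ≤ i.val ∧ i.val < m + 6 ∧ m + 3 ≤ j.val ∧ j.val < m + 6) ∨
      (i.val < 3 ∧ (j.val = i.val + (m + 3) ∨ j.val = i.val + (m + 6))) ∨
      (j.val < 3 ∧ (i.val = j.val + (m + 3) ∨ i.val = j.val + (m + 6))) ∨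
      (m + 3 ≤ i.val ∧ i.val < m + 6 ∧ j.val = i.val + 3) ∨
      (m + 3 ≤ j.val ∧ j.val < m + 6 ∧ i.val = j.val + 3)) := by
  simp only [EPgraph, SimpleGraph.fromRel_adj, ne_eq, Fin.ext_iff,
    show m + 9 - 6 = m + 3 by omega, show m + 9 - 3 = m + 6 by omega]
  omega

theorem EPgraph_eigenvector (m : ℕ) [DecidableRel (EPgraph (m + 9)).Adj] (a d b c q : ℝ)
    (hd : (q - 2 * m - 1) * d = 3 * a) (ha : (q - m - 6) * a = m * d + b + c)
    (hb : (q - 6) * b = a + c) (hc : (q - 2) * c = a + b) (i : Fin (m + 9)) :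
    (∑ j, if (EPgraph (m + 9)).Adj i j then
      epVector m a d b c i.val + epVector m a d b c j.val else 0) = q * epVector m a d b c i.val := by
  simp only [EPgraph_adj_iff]
  obtain ⟨i, hi⟩ := i
  simp only
  rw [Fin.sum_univ_eq_sum_range (fun j => if i ≠ j ∧ ((i < m + 3 ∧ j < m + 3) ∨
      (m + 3 ≤ i ∧ i < m + 6 ∧ m + 3 ≤ j ∧ j < m + 6) ∨
      (i < 3 ∧ (j = i + (m + 3) ∨ j = i + (m + 6))) ∨
      (j < 3 ∧ (i = j + (m + 3) ∨ i = j + (m + 6))) ∨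
      (m + 3 ≤ i ∧ i < m + 6 ∧ j = i + 3) ∨
      (m + 3 ≤ j ∧ j < m + 6 ∧ i = j + 3)) then
      epVector m a d b c i + epVector m a d b c j else 0) (m + 9), sum_range_add_nine]
  have hmid : ∀ f g : ℕ → ℝ, (∀ k < m, f k = g k) →
      ∑ k ∈ Finset.range m, f k = ∑ k ∈ Finset.range m, g k :=
    fun f g h => Finset.sum_congr rfl fun k hk => h k (Finset.mem_range.1 hk)
  rcases (by omega : i = 0 ∨ i = 1 ∨ i = 2 ∨ (3 ≤ i ∧ i < m + 3) ∨ i = m + 3 ∨ i = m + 4 ∨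
    i = m + 5 ∨ i = m + 6 ∨ i = m + 7 ∨ i = m + 8) with
    rfl | rfl | rfl | h | rfl | rfl | rfl | rfl | rfl | rfl
  iterate 3
    rw [hmid _ (fun _ => a + d) (fun k hk => by simp +arith [epVector, hk])]
    simp +arith [epVector]
    linear_combination -ha
  · obtain ⟨k, rfl⟩ := Nat.exists_eq_add_of_le' h.1
    have hk : k < m := by omega
    rw [hmid _ (fun l => 2 * d - if k = l then 2 * d else 0) (fun l hl => by
      by_cases hkl : k = l <;> simp +arith [epVector, hk, hl, hkl]; ring)]
    have hne : ∀ t, k ≠ m + t := by omega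
    simp +arith [epVector, hk, hk.not_ge, hk.ne, hne]
    linear_combination -hd
  iterate 3
    rw [hmid _ (fun _ => 0) (fun k hk => by simp +arith [epVector, hk, hk.ne', hk.not_ge]; omega)]
    simp +arith [epVector]
    linear_combination -hb
  iterate 3
    rw [hmid _ (fun _ => 0) (fun k hk => by simp +arith [hk, hk.ne', hk.not_ge])]
    simp +arith [epVector]
    linear_combination -hc

theorem exists_EPgraph_root (n : ℝ) (hn : n = 10 ∨ 11 ≤ n) :
    ∃ q : ℝ, 7 ≤ q ∧ 2 * n - 14 ≤ q ∧
      (3 * n - 27) * (q ^ 2 - 8 * q + 11) =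
        (q - 2 * n + 17) * ((q - n + 3) * (q ^ 2 - 8 * q + 11) - (2 * q - 6)) := by
  set f : ℝ → ℝ := fun q => (q - 2 * n + 17) *
    ((q - n + 3) * (q ^ 2 - 8 * q + 11) - (2 * q - 6)) - (3 * n - 27) * (q ^ 2 - 8 * q + 11)
    with hf
  have hcont : Continuous f := by fun_prop
  obtain ⟨l, h7, hl, hln, hneg⟩ : ∃ l, 7 ≤ l ∧ 2 * n - 14 ≤ l ∧ l ≤ 2 * n ∧ f l ≤ 0 := by
    rcases hn with rfl | hn
    · exact ⟨7, by norm_num, by norm_num, by norm_num, by norm_num [hf]⟩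
    · exact ⟨2 * n - 14, by linarith, le_rfl, by linarith, by simp only [hf]; nlinarith⟩
  have hn' : 10 ≤ n := by rcases hn with rfl | hn <;> linarith
  have hpos : 0 ≤ f (2 * n) := by
    simp only [hf]
    have : 0 ≤ n * (n - 10) ^ 2 := by positivity
    nlinarith [mul_nonneg (sub_nonneg.2 hn') (sub_nonneg.2 hn')]
  obtain ⟨q, ⟨hq, -⟩, h0⟩ := intermediate_value_Icc hln hcont.continuousOn ⟨hneg, hpos⟩
  exact ⟨q, h7.trans hq, hl.trans hq, by simp only [hf] at h0; linarith⟩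

theorem statement_15 (n : ℕ) (hn : 10 ≤ n) :
    (3 * (n : ℝ) - 27) * ((qIndex (EPgraph n)) ^ 2 - 8 * qIndex (EPgraph n) + 11) =
      (qIndex (EPgraph n) - 2 * (n : ℝ) + 17) *
        ((qIndex (EPgraph n) - (n : ℝ) + 3) *
            ((qIndex (EPgraph n)) ^ 2 - 8 * qIndex (EPgraph n) + 11) -
          (2 * qIndex (EPgraph n) - 6)) := by
  obtain ⟨q, h7, hq, h⟩ := exists_EPgraph_root n (by
    rcases hn.eq_or_lt with h | h
    · left; exact_mod_cast h.symm
    · right; exact_mod_cast h)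
  suffices qIndex (EPgraph n) = q by rwa [this]
  classical
  obtain ⟨m, rfl⟩ : ∃ m, n = m + 9 := ⟨n - 9, by omega⟩
  push_cast at h hq
  have hR : 0 < q ^ 2 - 8 * q + 11 := by nlinarith
  have hS : 0 < q - 2 * m - 1 := by linarith
  generalize hRq : q ^ 2 - 8 * q + 11 = R at h hR
  generalize hSq : q - 2 * (m : ℝ) - 1 = S at hS
  refine qIndex_eq_of_pos_eigenvector _
    (fun i => epVector m 1 (3 / S) ((q - 1) / R) ((q - 5) / R) i.val) q
    (fun i => ?_) (EPgraph_eigenvector m _ _ _ _ q ?_ ?_ ?_ ?_)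
  · have h1 : 0 < q - 1 := by linarith
    have h5 : 0 < q - 5 := by linarith
    unfold epVector
    split_ifs <;> positivity
  · rw [hSq]
    field_simp
  · field_simp
    rw [← hSq]
    linear_combination -h
  · field_simp
    linear_combination hRq
  · field_simp
    linear_combination hRq
end
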